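/- For every δ ∈ (0,1] there exists a constant c > 0, depending only on p, δ, C0 and C1, such that for every ε ∈ (0,1], every (C0,C1)-elliptic symmetric matrix γ and all ξ, ξ̃ ∈ ℝ^{nN} one has ε^{1/2} |ξ − ξ̃|²_γ + |G_δ(γ,ξ) − G_δ(γ,ξ̃)|^p_γ ≤ ε^{1/2} |ξ|²_γ + c ε^{−1/2} ⟨A_ε(γ,ξ̃) − A_ε(γ,ξ), ξ̃ − ξ⟩_γ. -/

import Mathlib

noncomputable section

open Real

/-- The `γ`-inner product on `ℝ^{nN}`. -/
def gInner {n N : ℕ} (γ : Matrix (Fin n) (Fin n) ℝ) (ξ η : Fin N → Fin n → ℝ) : ℝ :=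
  ∑ i, ∑ α, ∑ β, γ α β * ξ i α * η i β

/-- The `γ`-norm on `ℝ^{nN}`. -/
def gNorm {n N : ℕ} (γ : Matrix (Fin n) (Fin n) ℝ) (ξ : Fin N → Fin n → ℝ) : ℝ :=
  Real.sqrt (gInner γ ξ ξ)

/-- The Euclidean norm on `ℝ^{nN}`. -/
def eNorm {n N : ℕ} (ξ : Fin N → Fin n → ℝ) : ℝ :=
  Real.sqrt (∑ i, ∑ α, ξ i α ^ 2)

/-- A symmetric `(C0, C1)`-elliptic matrix. -/
def IsElliptic {n : ℕ} (C0 C1 : ℝ) (γ : Matrix (Fin n) (Fin n) ℝ) : Prop :=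
  (∀ α β, γ α β = γ β α) ∧
  ∀ ζ : Fin n → ℝ,
    C0 * ∑ α, ζ α ^ 2 ≤ (∑ α, ∑ β, γ α β * ζ α * ζ β) ∧
    (∑ α, ∑ β, γ α β * ζ α * ζ β) ≤ C1 * ∑ α, ζ α ^ 2

/-- `h(t) = (t-1)_+^{p-1} / t` (with the convention `h(0) = 0`). -/
def hfun (p t : ℝ) : ℝ := (max (t - 1) 0) ^ (p - 1) / t

/-- `g(t) = (t-1)_+^p / t`. -/
def gfun (p t : ℝ) : ℝ := (max (t - 1) 0) ^ p / t

/-- The derivative of `h` on `(1,∞)`, extended by `0` elsewhere. -/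
def hderiv (p s : ℝ) : ℝ :=
  if 1 < s then (s - 1) ^ (p - 2) * ((p - 2) * s + 1) / s ^ 2 else 0

/-- The derivative of `g` on `(1,∞)`, extended by `0` elsewhere. -/
def gderiv (p s : ℝ) : ℝ :=
  if 1 < s then (s - 1) ^ (p - 1) * ((p - 1) * s + 1) / s ^ 2 else 0

/-- `λ(t) = min{h(t), (p-1)(t-1)^{p-2}}` for `t > 1`, and `0` for `t ≤ 1`. -/
def lamFun (p t : ℝ) : ℝ :=
  if 1 < t then min (hfun p t) ((p - 1) * (t - 1) ^ (p - 2)) else 0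

/-- `Λ(t) = max{h(t), (p-1)(t-1)^{p-2}}` for `t > 1`, and `0` for `t ≤ 1`. -/
def LamFun (p t : ℝ) : ℝ :=
  if 1 < t then max (hfun p t) ((p - 1) * (t - 1) ^ (p - 2)) else 0

/-- The vector field `A_ε(γ, ξ) = h_ε(|ξ|_γ) ξ` (equal to `0` at `ξ = 0`). -/
def Avf {n N : ℕ} (p ε : ℝ) (γ : Matrix (Fin n) (Fin n) ℝ) (ξ : Fin N → Fin n → ℝ) :
    Fin N → Fin n → ℝ :=
  fun i α => (hfun p (gNorm γ ξ) + ε) * ξ i α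

/-- The map `G_δ(γ, ξ) = ((|ξ|_γ - 1 - δ)_+ / |ξ|_γ) ξ` (equal to `0` at `ξ = 0`). -/
def Gmap {n N : ℕ} (δ : ℝ) (γ : Matrix (Fin n) (Fin n) ℝ) (ξ : Fin N → Fin n → ℝ) :
    Fin N → Fin n → ℝ :=
  fun i α => (max (gNorm γ ξ - 1 - δ) 0) / gNorm γ ξ * ξ i α

/-- The bilinear form `𝒜_ε(γ, ξ)` on third-order tensors in `ℝ^{n²N}`. -/
def Aform {n N : ℕ} (p ε : ℝ) (γ : Matrix (Fin n) (Fin n) ℝ) (ξ : Fin N → Fin n → ℝ)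
    (η ζ : Fin N → Fin n → Fin n → ℝ) : ℝ :=
  ∑ i, ∑ j, ∑ α, ∑ β, ∑ ν, ∑ σ,
    ((hfun p (gNorm γ ξ) + ε) * γ α β * (if i = j then (1 : ℝ) else 0) +
        hderiv p (gNorm γ ξ) / gNorm γ ξ *
          (∑ d, γ α d * ξ i d) * (∑ k, γ β k * ξ j k)) *
      γ ν σ * η i α ν * ζ j β σ

/-- The bilinear form `ℬ_ε(γ, ξ)` on `ℝ^{nN}`. -/
def Bform {n N : ℕ} (p ε : ℝ) (γ : Matrix (Fin n) (Fin n) ℝ) (ξ : Fin N → Fin n → ℝ)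
    (η ζ : Fin N → Fin n → ℝ) : ℝ :=
  ∑ i, ∑ j, ∑ α, ∑ β,
    ((hfun p (gNorm γ ξ) + ε) * γ α β * (if i = j then (1 : ℝ) else 0) +
        hderiv p (gNorm γ ξ) / gNorm γ ξ *
          (∑ d, γ α d * ξ i d) * (∑ k, γ β k * ξ j k)) *
      η i α * ζ j β

/-- The bilinear form `𝒞_ε(γ, ξ)` on `ℝ^n`. -/
def Cform {n N : ℕ} (p ε : ℝ) (γ : Matrix (Fin n) (Fin n) ℝ) (ξ : Fin N → Fin n → ℝ)
    (ζ ζ' : Fin n → ℝ) : ℝ :=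
  ∑ α, ∑ β,
    ((hfun p (gNorm γ ξ) + ε) * γ α β +
        hderiv p (gNorm γ ξ) / gNorm γ ξ *
          (∑ i, (∑ d, γ α d * ξ i d) * (∑ k, γ β k * ξ i k))) *
      ζ α * ζ' β

/-- The squared `γ`-norm of a third-order tensor in `ℝ^{n²N}`. -/
def tNormSq {n N : ℕ} (γ : Matrix (Fin n) (Fin n) ℝ) (η : Fin N → Fin n → Fin n → ℝ) : ℝ :=
  ∑ i, ∑ α, ∑ β, ∑ ν, ∑ σ, γ α β * γ ν σ * η i α ν * η i β σ

lemma gInner_sub_smul {n N : ℕ} {γ : Matrix (Fin n) (Fin n) ℝ} (hγ : ∀ α β, γ α β = γ β α)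
    (ξ η : Fin N → Fin n → ℝ) (k l k' l' : ℝ) :
    gInner γ (fun i α => k * ξ i α - l * η i α) (fun i α => k' * ξ i α - l' * η i α) =
      k * k' * gInner γ ξ ξ - (k * l' + l * k') * gInner γ ξ η + l * l' * gInner γ η η := by
  have hsymm : gInner γ ξ η = gInner γ η ξ := by
    unfold gInner
    refine Finset.sum_congr rfl fun i _ => ?_
    rw [Finset.sum_comm]
    refine Finset.sum_congr rfl fun α _ => Finset.sum_congr rfl fun β _ => ?_
    rw [hγ β α]
    ring
  have hexp : gInner γ (fun i α => k * ξ i α - l * η i α) (fun i α => k' * ξ i α - l' * η i α) =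
      k * k' * gInner γ ξ ξ - k * l' * gInner γ ξ η - l * k' * gInner γ η ξ
        + l * l' * gInner γ η η := by
    simp only [gInner, Finset.mul_sum, ← Finset.sum_add_distrib, ← Finset.sum_sub_distrib]
    refine Finset.sum_congr rfl fun i _ => Finset.sum_congr rfl fun α _ =>
      Finset.sum_congr rfl fun β _ => ?_
    ring
  rw [hexp, ← hsymm]
  ring

lemma IsElliptic.gInner_self_nonneg {n N : ℕ} {C0 C1 : ℝ} {γ : Matrix (Fin n) (Fin n) ℝ}
    (hγ : IsElliptic C0 C1 γ) (hC0 : 0 ≤ C0) (ξ : Fin N → Fin n → ℝ) : 0 ≤ gInner γ ξ ξ :=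
  Finset.sum_nonneg fun i _ =>
    (mul_nonneg hC0 (Finset.sum_nonneg fun α _ => sq_nonneg (ξ i α))).trans (hγ.2 (ξ i)).1

/-- Cauchy–Schwarz, phrased through the cosine of the angle between two vectors. -/
lemma IsElliptic.exists_gInner_eq {n N : ℕ} {C0 C1 : ℝ} {γ : Matrix (Fin n) (Fin n) ℝ}
    (hγ : IsElliptic C0 C1 γ) (hC0 : 0 ≤ C0) (ξ η : Fin N → Fin n → ℝ) :
    ∃ ρ : ℝ, -1 ≤ ρ ∧ ρ ≤ 1 ∧ gInner γ ξ η = gNorm γ ξ * gNorm γ η * ρ := by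
  have hquad : ∀ t : ℝ,
      0 ≤ gInner γ ξ ξ * (t * t) + (-2 * gInner γ ξ η) * t + gInner γ η η := by
    intro t
    have h := hγ.gInner_self_nonneg hC0 fun i α => t * ξ i α - 1 * η i α
    rw [gInner_sub_smul hγ.1] at h
    linarith
  have hdisc := discrim_le_zero hquad
  have hle : |gInner γ ξ η| ≤ gNorm γ ξ * gNorm γ η := by
    refine abs_le_of_sq_le_sq ?_ (mul_nonneg (sqrt_nonneg _) (sqrt_nonneg _))
    rw [mul_pow, gNorm, gNorm, sq_sqrt (hγ.gInner_self_nonneg hC0 ξ),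
      sq_sqrt (hγ.gInner_self_nonneg hC0 η)]
    unfold discrim at hdisc
    linarith
  have hpos : 0 ≤ gNorm γ ξ * gNorm γ η := (abs_nonneg _).trans hle
  rcases hpos.eq_or_lt with h0 | h0
  · refine ⟨0, by norm_num, by norm_num, ?_⟩
    rw [← h0] at hle
    simpa using hle
  · refine ⟨gInner γ ξ η / (gNorm γ ξ * gNorm γ η), ?_, ?_, ?_⟩
    · rw [le_div_iff₀ h0]
      linarith [(abs_le.mp hle).1]
    · rw [div_le_one h0]
      exact (abs_le.mp hle).2
    · exact (mul_div_cancel₀ _ h0.ne').symm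

/-- Degenerate monotonicity of the `p`-Laplacian for `p ≥ 2`, in polar coordinates: `u` and `v` are
the lengths of two vectors and `1 - w` is the cosine of the angle between them. -/
lemma rpow_mul_le_of_two_le {p u v w : ℝ} (hp : 2 ≤ p) (hv : 0 ≤ v) (hvu : v ≤ u) (hu : 0 < u)
    (hw : 0 ≤ w) :
    u ^ (p - 2) * ((u - v) ^ 2 + 2 * u * v * w) ≤
      2 * ((u ^ (p - 1) - v ^ (p - 1)) * (u - v) + (u ^ (p - 1) * v + v ^ (p - 1) * u) * w) := by
  have hpow : u ^ (p - 1) = u ^ (p - 2) * u := by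
    rw [← rpow_add_one hu.ne']
    ring_nf
  have hvp : v ^ (p - 1) ≤ u ^ (p - 2) * v := by
    rcases hv.eq_or_lt with rfl | hv0
    · rw [zero_rpow (by linarith)]
      simp
    · have : v ^ (p - 1) = v ^ (p - 2) * v := by
        rw [← rpow_add_one hv0.ne']
        ring_nf
      rw [this]
      gcongr
  have hv1 : 0 ≤ v ^ (p - 1) := by positivity
  have hd : 0 ≤ u - v := by linarith
  rw [hpow]
  have h1 : 0 ≤ (u ^ (p - 2) * v - v ^ (p - 1)) * (u - v) :=
    mul_nonneg (by linarith) hd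
  have h2 : 0 ≤ u ^ (p - 2) * (u - v) ^ 2 := by positivity
  have h3 : 0 ≤ v ^ (p - 1) * u * w := by positivity
  nlinarith

/-- Singular monotonicity of the `p`-Laplacian for `1 < p ≤ 2`, in polar coordinates. -/
lemma rpow_mul_le_of_le_two {p u v w : ℝ} (hp : 1 < p) (hp2 : p ≤ 2) (hv : 0 ≤ v) (hvu : v ≤ u)
    (hu : 0 < u) (hw : 0 ≤ w) :
    (p - 1) * (u ^ (p - 2) * ((u - v) ^ 2 + 2 * u * v * w)) ≤
      (u ^ (p - 1) - v ^ (p - 1)) * (u - v) + (u ^ (p - 1) * v + v ^ (p - 1) * u) * w := by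
  have hpow : u ^ (p - 1) = u ^ (p - 2) * u := by
    rw [← rpow_add_one hu.ne']
    ring_nf
  have hvp : u ^ (p - 2) * v ≤ v ^ (p - 1) := by
    rcases hv.eq_or_lt with rfl | hv0
    · rw [zero_rpow (by linarith)]
      simp
    · have : v ^ (p - 1) = v ^ (p - 2) * v := by
        rw [← rpow_add_one hv0.ne']
        ring_nf
      rw [this]
      exact mul_le_mul_of_nonneg_right (rpow_le_rpow_of_nonpos hv0 hvu (by linarith)) hv
  have htan : v ^ (p - 1) ≤ u ^ (p - 2) * u + (p - 1) * u ^ (p - 2) * (v - u) := by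
    have hB := rpow_one_add_le_one_add_mul_self (s := v / u - 1) (p := p - 1)
      (by linarith [div_nonneg hv hu.le]) (by linarith) (by linarith)
    rw [add_sub_cancel, div_rpow hv hu.le, div_le_iff₀ (by positivity), hpow] at hB
    refine hB.trans (le_of_eq ?_)
    field_simp
  have hP : 0 < u ^ (p - 2) := by positivity
  have hd : 0 ≤ u - v := by linarith
  rw [hpow]
  have h1 := mul_nonneg (sub_nonneg.2 htan) hd
  have h2 : 0 ≤ (v ^ (p - 1) - u ^ (p - 2) * v) * (u * w) :=
    mul_nonneg (by linarith) (by positivity)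
  have h3 : 0 ≤ (2 - p) * (u ^ (p - 2) * u * v * w) :=
    mul_nonneg (by linarith) (by positivity)
  nlinarith

/-- The `p`-th power of a distance `d` in polar coordinates is controlled by the monotonicity
expression of the `p`-Laplacian when `p ≥ 2`. -/
lemma dist_rpow_le_of_two_le {p u v w d : ℝ} (hp : 2 ≤ p) (hu : 0 ≤ u) (hv : 0 ≤ v)
    (hw : 0 ≤ w) (hw2 : w ≤ 2) (hd : 0 ≤ d) (hd2 : d ^ 2 = (u - v) ^ 2 + 2 * u * v * w) :
    d ^ p ≤ 2 ^ p *
      ((u ^ (p - 1) - v ^ (p - 1)) * (u - v) + (u ^ (p - 1) * v + v ^ (p - 1) * u) * w) := by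
  wlog hvu : v ≤ u generalizing u v
  · have h := this hv hu (by linarith) (le_of_not_ge hvu)
    linarith
  have hdle : d ≤ 2 * u := by
    refine abs_le_of_sq_le_sq' ?_ (by linarith) |>.2
    nlinarith [mul_nonneg (mul_nonneg hu hv) (sub_nonneg.2 hw2), mul_nonneg hv (sub_nonneg.2 hvu),
      mul_nonneg hu (sub_nonneg.2 hvu)]
  rcases hd.eq_or_lt with rfl | hd0
  · rcases hu.eq_or_lt with rfl | hu0
    · have : v = 0 := le_antisymm hvu hv
      subst this
      simp [zero_rpow (show p ≠ 0 by linarith)]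
    · have hk := rpow_mul_le_of_two_le hp hv hvu hu0 hw
      rw [← hd2] at hk
      rw [zero_rpow (by linarith)]
      exact mul_nonneg (by positivity) (by linarith)
  have hu0 : 0 < u := by linarith
  have hk := rpow_mul_le_of_two_le hp hv hvu hu0 hw
  rw [← hd2] at hk
  have hdp : d ^ p = d ^ (p - 2) * d ^ 2 := by
    rw [← rpow_natCast, ← rpow_add hd0]
    norm_num
  have h2p : (2 : ℝ) ^ p = 2 ^ (p - 2) * 2 ^ 2 := by
    rw [← rpow_natCast, ← rpow_add two_pos]
    norm_num
  have hle : d ^ (p - 2) ≤ 2 ^ (p - 2) * u ^ (p - 2) := by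
    rw [← mul_rpow zero_le_two hu]
    exact rpow_le_rpow hd hdle (by linarith)
  have hE := (show 0 ≤ u ^ (p - 2) * d ^ 2 by positivity).trans hk
  rw [hdp, h2p]
  calc d ^ (p - 2) * d ^ 2 ≤ 2 ^ (p - 2) * u ^ (p - 2) * d ^ 2 := by gcongr
    _ = 2 ^ (p - 2) * (u ^ (p - 2) * d ^ 2) := by ring
    _ ≤ 2 ^ (p - 2) * _ := mul_le_mul_of_nonneg_left hk (by positivity)
    _ ≤ _ := by
      rw [mul_assoc]
      refine mul_le_mul_of_nonneg_left ?_ (by positivity)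
      linarith

/-- The counterpart of `dist_rpow_le_of_two_le` for `1 < p ≤ 2`, with an absorbable error term. -/
lemma dist_rpow_le_of_le_two {p u v w d σ : ℝ} (hp : 1 < p) (hp2 : p ≤ 2) (hu : 0 ≤ u)
    (hv : 0 ≤ v) (hw : 0 ≤ w) (hd : 0 ≤ d) (hd2 : d ^ 2 = (u - v) ^ 2 + 2 * u * v * w)
    (hσ : 0 < σ) (hσ1 : σ ≤ 1) :
    d ^ p ≤ σ * u ^ p + 2 / (p - 1) / σ *
      ((u ^ (p - 1) - v ^ (p - 1)) * (u - v) + (u ^ (p - 1) * v + v ^ (p - 1) * u) * w) := by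
  set E := (u ^ (p - 1) - v ^ (p - 1)) * (u - v) + (u ^ (p - 1) * v + v ^ (p - 1) * u) * w with hE
  obtain ⟨M, hM0, huM, hvM, hMd, hMk⟩ : ∃ M, 0 ≤ M ∧ u ≤ M ∧ v ≤ M ∧ M ≤ u + d ∧
      (0 < M → (p - 1) * (M ^ (p - 2) * d ^ 2) ≤ E) := by
    rcases le_total v u with h | h
    · refine ⟨u, hu, le_rfl, h, by linarith, fun hu0 => ?_⟩
      rw [hd2]
      exact rpow_mul_le_of_le_two hp hp2 hv h hu0 hw
    · refine ⟨v, hv, h, le_rfl, ?_, fun hv0 => ?_⟩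
      · have : v - u ≤ d := by
          refine abs_le_of_sq_le_sq' ?_ hd |>.2
          nlinarith [mul_nonneg (mul_nonneg hu hv) hw]
        linarith
      · have hk := rpow_mul_le_of_le_two hp hp2 hu h hv0 hw
        have hsq : d ^ 2 = (v - u) ^ 2 + 2 * v * u * w := by rw [hd2]; ring
        rw [hsq, hE]
        linarith
  have hp1 : 0 < p - 1 := by linarith
  rcases hM0.eq_or_lt with rfl | hM
  · have hu' : u = 0 := le_antisymm huM hu
    have hv' : v = 0 := le_antisymm hvM hv
    have hd' : d = 0 := by
      rw [hu', hv'] at hd2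
      simpa using hd2
    simp [hE, hu', hv', hd', zero_rpow (show p ≠ 0 by linarith)]
  have hk := hMk hM
  have hE0 : 0 ≤ E := (show 0 ≤ (p - 1) * (M ^ (p - 2) * d ^ 2) by positivity).trans hk
  rcases le_or_gt (2 * d) (σ * M) with hcase | hcase
  · have hdu : d ≤ σ * u := by nlinarith
    have h1 : d ^ p ≤ σ * u ^ p := by
      calc d ^ p ≤ (σ * u) ^ p := rpow_le_rpow hd hdu (by linarith)
        _ = σ ^ p * u ^ p := mul_rpow hσ.le hu
        _ ≤ σ * u ^ p := by
          gcongr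
          exact rpow_le_self_of_le_one hσ.le hσ1 hp.le
    have h2 : 0 ≤ 2 / (p - 1) / σ * E := by positivity
    linarith
  · have hd0 : 0 < d := by nlinarith [mul_pos hσ hM]
    have hdp : d ^ p = d ^ (p - 2) * d ^ 2 := by
      rw [← rpow_natCast, ← rpow_add hd0]
      norm_num
    have hM' : M ≤ 2 / σ * d := by
      rw [div_mul_eq_mul_div, le_div_iff₀ hσ]
      linarith
    have hτ : 1 ≤ 2 / σ := by
      rw [le_div_iff₀ hσ]
      linarith
    have h3 : d ^ (p - 2) ≤ 2 / σ * M ^ (p - 2) := by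
      have h4 : (2 / σ * d) ^ (p - 2) ≤ M ^ (p - 2) :=
        rpow_le_rpow_of_nonpos hM hM' (by linarith)
      rw [mul_rpow (by positivity) hd] at h4
      have h5 : 1 ≤ 2 / σ * (2 / σ) ^ (p - 2) := by
        rw [mul_comm, ← rpow_add_one (by positivity)]
        exact one_le_rpow hτ (by linarith)
      calc d ^ (p - 2) = 1 * d ^ (p - 2) := (one_mul _).symm
        _ ≤ 2 / σ * (2 / σ) ^ (p - 2) * d ^ (p - 2) := by gcongr
        _ = 2 / σ * ((2 / σ) ^ (p - 2) * d ^ (p - 2)) := by ring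
        _ ≤ 2 / σ * M ^ (p - 2) := by gcongr
    have h6 : d ^ p ≤ 2 / (p - 1) / σ * E := by
      calc d ^ p = d ^ (p - 2) * d ^ 2 := hdp
        _ ≤ 2 / σ * M ^ (p - 2) * d ^ 2 := by gcongr
        _ = 2 / (p - 1) / σ * ((p - 1) * (M ^ (p - 2) * d ^ 2)) := by field_simp
        _ ≤ _ := by gcongr
    have h7 : 0 ≤ σ * u ^ p := by positivity
    linarith

/-- Replacing the lengths `a`, `b` by the truncations `(a - 1)_+`, `(b - 1)_+` in the second factor
decreases the monotonicity expression. -/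
lemma truncated_mono_le {a b w f g : ℝ} (hf : 0 ≤ f) (hg : 0 ≤ g)
    (ha0 : 0 ≤ a) (hb0 : 0 ≤ b)
    (hfa : a ≤ 1 → f = 0) (hgb : b ≤ 1 → g = 0) (hw : 0 ≤ w) :
    (f - g) * (max (a - 1) 0 - max (b - 1) 0) + (f * max (b - 1) 0 + g * max (a - 1) 0) * w ≤
      (f - g) * (a - b) + (f * b + g * a) * w := by
  rcases le_total a 1 with ha | ha <;> rcases le_total b 1 with hb | hb
  · simp [hfa ha, hgb hb]
  · rw [hfa ha, max_eq_right (by linarith), max_eq_left (by linarith)]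
    nlinarith [mul_nonneg hg (sub_nonneg.2 ha), mul_nonneg (mul_nonneg hg ha0) hw]
  · rw [hgb hb, max_eq_left (by linarith), max_eq_right (by linarith)]
    nlinarith [mul_nonneg hf (sub_nonneg.2 hb), mul_nonneg (mul_nonneg hf hb0) hw]
  · rw [max_eq_left (by linarith), max_eq_left (by linarith)]
    nlinarith [mul_nonneg hf hw, mul_nonneg hg hw]

/-- Truncating lengths further decreases the distance in polar coordinates. -/
lemma truncated_dist_sq_le {a b w δ : ℝ} (hδ : 0 ≤ δ) (hw : 0 ≤ w) :
    (max (a - 1 - δ) 0 - max (b - 1 - δ) 0) ^ 2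
        + 2 * max (a - 1 - δ) 0 * max (b - 1 - δ) 0 * w ≤
      (max (a - 1) 0 - max (b - 1) 0) ^ 2 + 2 * max (a - 1) 0 * max (b - 1) 0 * w := by
  have key : ∀ s : ℝ, max (s - δ) 0 = max (max s 0 - δ) 0 := by
    intro s
    rcases le_total s 0 with hs | hs
    · rw [max_eq_right hs, max_eq_right (by linarith), max_eq_right (by linarith)]
    · rw [max_eq_left hs]
  have hle : ∀ s : ℝ, 0 ≤ s → max (s - δ) 0 ≤ s := fun s hs => max_le (by linarith) hs
  rw [key (a - 1), key (b - 1)]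
  have hu : 0 ≤ max (a - 1) 0 := le_max_right _ _
  have hv : 0 ≤ max (b - 1) 0 := le_max_right _ _
  generalize max (a - 1) 0 = u at *
  generalize max (b - 1) 0 = v at *
  have h1 : (max (u - δ) 0 - max (v - δ) 0) ^ 2 ≤ (u - v) ^ 2 := by
    refine sq_le_sq.2 ((abs_max_sub_max_le_abs _ _ _).trans (le_of_eq ?_))
    ring_nf
  have h2 : 2 * max (u - δ) 0 * max (v - δ) 0 * w ≤ 2 * u * v * w := by
    gcongr
    exacts [hle u hu, hle v hv]
  linarith

/-- Lemma `lem9`. -/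
theorem statement15 (p C0 C1 : ℝ) (hp : 1 < p) (hC0 : 0 < C0) (hC01 : C0 ≤ C1)
    (δ : ℝ) (hδ0 : 0 < δ) (hδ1 : δ ≤ 1) :
    ∃ c : ℝ, 0 < c ∧
      ∀ (n N : ℕ), 1 ≤ n → 1 ≤ N →
        ∀ ε : ℝ, 0 < ε → ε ≤ 1 →
          ∀ γ : Matrix (Fin n) (Fin n) ℝ, IsElliptic C0 C1 γ →
            ∀ ξ ξ' : Fin N → Fin n → ℝ,
              Real.sqrt ε *
                  gInner γ (fun i α => ξ i α - ξ' i α) (fun i α => ξ i α - ξ' i α) +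
                  gNorm γ (fun i α => Gmap δ γ ξ i α - Gmap δ γ ξ' i α) ^ p ≤
                Real.sqrt ε * gInner γ ξ ξ +
                  c / Real.sqrt ε *
                    gInner γ (fun i α => Avf p ε γ ξ' i α - Avf p ε γ ξ i α)
                      (fun i α => ξ' i α - ξ i α) := by
  refine ⟨1 + (2 ^ p + 2 / (p - 1)), ?_, ?_⟩
  · have : 0 < 2 / (p - 1) := div_pos two_pos (by linarith)
    positivity
  intro n N _ _ ε hε hε1 γ hγ ξ ξ'
  obtain ⟨ρ, hρ1, hρ2, hQ⟩ := hγ.exists_gInner_eq hC0.le ξ ξ'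
  have hX : gInner γ ξ ξ = gNorm γ ξ ^ 2 := (sq_sqrt (hγ.gInner_self_nonneg hC0.le ξ)).symm
  have hY : gInner γ ξ' ξ' = gNorm γ ξ' ^ 2 := (sq_sqrt (hγ.gInner_self_nonneg hC0.le ξ')).symm
  have ha0 : 0 ≤ gNorm γ ξ := sqrt_nonneg _
  have hb0 : 0 ≤ gNorm γ ξ' := sqrt_nonneg _
  have hD : gInner γ (fun i α => ξ i α - ξ' i α) (fun i α => ξ i α - ξ' i α) =
      gNorm γ ξ ^ 2 - 2 * (gNorm γ ξ * gNorm γ ξ' * ρ) + gNorm γ ξ' ^ 2 := by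
    have h := gInner_sub_smul hγ.1 ξ ξ' 1 1 1 1
    simp only [one_mul] at h
    rw [h, hX, hY, hQ]
    ring
  have hB : gInner γ (fun i α => Avf p ε γ ξ' i α - Avf p ε γ ξ i α)
      (fun i α => ξ' i α - ξ i α) =
      (hfun p (gNorm γ ξ) + ε) * gNorm γ ξ ^ 2
        - (hfun p (gNorm γ ξ) + ε + (hfun p (gNorm γ ξ') + ε)) * (gNorm γ ξ * gNorm γ ξ' * ρ)
        + (hfun p (gNorm γ ξ') + ε) * gNorm γ ξ' ^ 2 := by
    have h := gInner_sub_smul hγ.1 ξ ξ' (-(hfun p (gNorm γ ξ) + ε))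
      (-(hfun p (gNorm γ ξ') + ε)) (-1) (-1)
    rw [hX, hY, hQ] at h
    convert h using 1
    · congr 1
      · funext i α
        simp only [Avf]
        ring
      · funext i α
        ring
    · ring
  have hG : gInner γ (fun i α => Gmap δ γ ξ i α - Gmap δ γ ξ' i α)
      (fun i α => Gmap δ γ ξ i α - Gmap δ γ ξ' i α) = _ :=
    gInner_sub_smul hγ.1 ξ ξ' (max (gNorm γ ξ - 1 - δ) 0 / gNorm γ ξ)
      (max (gNorm γ ξ' - 1 - δ) 0 / gNorm γ ξ') (max (gNorm γ ξ - 1 - δ) 0 / gNorm γ ξ)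
      (max (gNorm γ ξ' - 1 - δ) 0 / gNorm γ ξ')
  rw [hX, hY, hQ] at hG
  rw [hD, hB, hX, show gNorm γ (fun i α => Gmap δ γ ξ i α - Gmap δ γ ξ' i α) =
    √(gInner γ (fun i α => Gmap δ γ ξ i α - Gmap δ γ ξ' i α)
      (fun i α => Gmap δ γ ξ i α - Gmap δ γ ξ' i α)) from rfl, hG]
  clear hD hB hG hX hY hQ
  generalize gNorm γ ξ = a at *
  generalize gNorm γ ξ' = b at *
  have hcancel : ∀ F : ℝ → ℝ, F 0 = 0 → ∀ t, F t / t * t = F t := by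
    intro F hF t
    exact div_mul_cancel_of_imp fun h => by rw [h, hF]
  have hp1 : p - 1 ≠ 0 := by linarith
  have hh : ∀ t, hfun p t * t = max (t - 1) 0 ^ (p - 1) :=
    hcancel (fun t => max (t - 1) 0 ^ (p - 1)) (by simp [zero_rpow hp1])
  have hg : ∀ t, max (t - 1 - δ) 0 / t * t = max (t - 1 - δ) 0 :=
    hcancel (fun t => max (t - 1 - δ) 0) (max_eq_right (by linarith))
  set σ := √ε with hσdef
  have hσ : 0 < σ := sqrt_pos.2 hε
  have hσ1 : σ ≤ 1 := sqrt_le_one.2 hε1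
  have hσ2 : ε = σ ^ 2 := (sq_sqrt hε.le).symm
  have hw : 0 ≤ 1 - ρ := by linarith
  have hw2 : 1 - ρ ≤ 2 := by linarith
  set u := max (a - 1) 0 with hu
  set v := max (b - 1) 0 with hv
  have hu0 : 0 ≤ u := le_max_right _ _
  have hv0 : 0 ≤ v := le_max_right _ _
  set f := u ^ (p - 1) with hf
  set g := v ^ (p - 1) with hg'
  set d := √((u - v) ^ 2 + 2 * u * v * (1 - ρ)) with hd
  have hd2 : d ^ 2 = (u - v) ^ 2 + 2 * u * v * (1 - ρ) := sq_sqrt (by positivity)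
  have hd0 : 0 ≤ d := sqrt_nonneg _
  set E := (f - g) * (u - v) + (f * v + g * u) * (1 - ρ) with hE
  have hEle : E ≤ (f - g) * (a - b) + (f * b + g * a) * (1 - ρ) :=
    truncated_mono_le (by positivity) (by positivity) ha0 hb0
      (fun h => by rw [hf, hu, max_eq_right (by linarith), zero_rpow hp1])
      (fun h => by rw [hg', hv, max_eq_right (by linarith), zero_rpow hp1]) hw
  have hgrow : √(max (a - 1 - δ) 0 / a * (max (a - 1 - δ) 0 / a) * a ^ 2 -
      (max (a - 1 - δ) 0 / a * (max (b - 1 - δ) 0 / b) +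
        max (b - 1 - δ) 0 / b * (max (a - 1 - δ) 0 / a)) * (a * b * ρ) +
      max (b - 1 - δ) 0 / b * (max (b - 1 - δ) 0 / b) * b ^ 2) ≤ d := by
    refine sqrt_le_sqrt (le_trans (le_of_eq ?_) (truncated_dist_sq_le hδ0.le hw))
    linear_combination
      (max (a - 1 - δ) 0 / a * a + max (a - 1 - δ) 0 - 2 * ρ * (max (b - 1 - δ) 0 / b * b)) * hg a
      + (max (b - 1 - δ) 0 / b * b + max (b - 1 - δ) 0 - 2 * ρ * max (a - 1 - δ) 0) * hg b
  have hEnn : 0 ≤ E := by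
    have h1 : 0 ≤ (f - g) * (u - v) := by
      rcases le_total u v with h | h
      · exact mul_nonneg_of_nonpos_of_nonpos
          (sub_nonpos.2 (rpow_le_rpow hu0 h (by linarith))) (by linarith)
      · exact mul_nonneg (sub_nonneg.2 (rpow_le_rpow hv0 h (by linarith))) (by linarith)
    positivity
  have hK : 0 < 2 / (p - 1) := div_pos two_pos (by linarith)
  have hmain : d ^ p ≤ σ * a ^ 2 + (2 ^ p + 2 / (p - 1)) / σ * E := by
    rcases le_total 2 p with h2 | h2
    · have h := dist_rpow_le_of_two_le h2 hu0 hv0 hw hw2 hd0 hd2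
      have h3 : (2 : ℝ) ^ p ≤ (2 ^ p + 2 / (p - 1)) / σ := by
        rw [le_div_iff₀ hσ]
        nlinarith [rpow_pos_of_pos two_pos p]
      have h4 : 0 ≤ σ * a ^ 2 := by positivity
      exact h.trans (by linarith [mul_le_mul_of_nonneg_right h3 hEnn])
    · have h := dist_rpow_le_of_le_two hp h2 hu0 hv0 hw hd0 hd2 hσ hσ1
      have h3 : 2 / (p - 1) / σ ≤ (2 ^ p + 2 / (p - 1)) / σ := by
        gcongr
        linarith [rpow_pos_of_pos two_pos p]
      have h4 : u ^ p ≤ a ^ 2 := by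
        rcases le_total a 1 with ha | ha
        · rw [hu, max_eq_right (by linarith), zero_rpow (by linarith)]
          positivity
        · rw [← rpow_natCast]
          exact (rpow_le_rpow hu0 (max_le (by linarith) ha0) (by linarith)).trans
            (rpow_le_rpow_of_exponent_le ha (by exact_mod_cast h2))
      exact h.trans (add_le_add (by gcongr) (mul_le_mul_of_nonneg_right h3 hEnn))
  have hpow := rpow_le_rpow (sqrt_nonneg _) hgrow (show 0 ≤ p by linarith)
  have hBeq : (hfun p a + ε) * a ^ 2 - (hfun p a + ε + (hfun p b + ε)) * (a * b * ρ)
      + (hfun p b + ε) * b ^ 2 =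
      σ ^ 2 * (a ^ 2 - 2 * (a * b * ρ) + b ^ 2)
        + ((f - g) * (a - b) + (f * b + g * a) * (1 - ρ)) := by
    rw [← hσ2]
    linear_combination (a - b * ρ) * hh a + (b - a * ρ) * hh b
  rw [hBeq]
  have hDnn : 0 ≤ a ^ 2 - 2 * (a * b * ρ) + b ^ 2 := by
    nlinarith [mul_nonneg (mul_nonneg ha0 hb0) hw, sq_nonneg (a - b)]
  generalize a ^ 2 - 2 * (a * b * ρ) + b ^ 2 = D at *
  generalize (f - g) * (a - b) + (f * b + g * a) * (1 - ρ) = B at *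
  have hK0 : 0 < 2 ^ p + 2 / (p - 1) := by positivity
  generalize 2 ^ p + 2 / (p - 1) = K at *
  have hKB : K / σ * E ≤ K / σ * B := by gcongr
  have hsplit : (1 + K) / σ * (σ ^ 2 * D + B) = σ * D + K * σ * D + K / σ * B + B / σ := by
    field_simp
    ring
  have hB0 : 0 ≤ B / σ := div_nonneg (hEnn.trans hEle) hσ.le
  have hKD : 0 ≤ K * σ * D := by positivity
  rw [hsplit]
  linarith
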